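/- Recursion identity for the degenerate Laplacian (Lemma A.2): Let n ≥ 1 and a, b ∈ ℝ. Suppose w : ℝⁿ × (0,∞) → ℝ is four times continuously differentiable and satisfies Δw(x) + (a/x_{n+1}) ∂_{n+1} w(x) = 0 for all x ∈ ℝⁿ × (0,∞). Then the function w₁ := Δw + (b/x_{n+1}) ∂_{n+1} w (equivalently w₁ = x_{n+1}^{−b} ∇·(x_{n+1}^b ∇w)) satisfies Δw₁(x) + ((a+2)/x_{n+1}) ∂_{n+1} w₁(x) = 0 for all x ∈ ℝⁿ × (0,∞). Consequently, if γ > 0, b = 1 − 2γ + 2⌊γ⌋, and u is smooth on ℝⁿ × (0,∞) with Δu + ((1−2γ)/x_{n+1}) ∂_{n+1} u = 0, then for each k ∈ {0,…,⌊γ⌋} the function w_k := Δ_b^k u (with Δ_b v := Δv + (b/x_{n+1}) ∂_{n+1} v) satisfies Δw_k + ((1−2γ+2k)/x_{n+1}) ∂_{n+1} w_k = 0 in ℝⁿ × (0,∞); in particular Δ_b^{⌊γ⌋+1} u = 0 in ℝⁿ × (0,∞). -/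

import Mathlib

open MeasureTheory Filter Set Topology
noncomputable section

/-- `ℝ^{n+1}` (ambient space of the upper half space `ℝⁿ × (0,∞)`). -/
abbrev UE (n : ℕ) := EuclideanSpace ℝ (Fin (n+1))

/-- The vertical coordinate `x_{n+1}`. -/
def lastc {n : ℕ} (x : UE n) : ℝ := x (Fin.last n)
/-- The open upper half space `ℝⁿ × (0,∞)`. -/
def HalfSpace (n : ℕ) : Set (UE n) := {x | 0 < lastc x}

/-- Partial derivative in direction `i`. -/
def pd {n : ℕ} (i : Fin (n+1)) (u : UE n → ℝ) (x : UE n) : ℝ :=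
  fderiv ℝ u x (EuclideanSpace.single i 1)

/-- The full Laplacian in the `n+1` variables. -/
def lap {n : ℕ} (u : UE n → ℝ) (x : UE n) : ℝ := ∑ i, pd i (pd i u) x

/-- The degenerate Laplacian `Δ_b u = Δu + (b/x_{n+1}) ∂_{n+1}u`. -/
def DeltaB {n : ℕ} (b : ℝ) (u : UE n → ℝ) (x : UE n) : ℝ :=
  lap u x + (b / lastc x) * pd (Fin.last n) u x

/-- The equation `Δw + (a/x_{n+1}) ∂_{n+1}w = 0` at the point `x`. -/
def DegEq {n : ℕ} (a : ℝ) (w : UE n → ℝ) (x : UE n) : Prop :=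
  lap w x + (a / lastc x) * pd (Fin.last n) w x = 0

theorem isOpen_halfSpace (n : ℕ) : IsOpen (HalfSpace n) :=
  isOpen_lt continuous_const (EuclideanSpace.proj (𝕜 := ℝ) (Fin.last n)).continuous

theorem hasFDerivAt_lastc {n : ℕ} (x : UE n) :
    HasFDerivAt (lastc (n := n)) (EuclideanSpace.proj (𝕜 := ℝ) (Fin.last n)) x :=
  (EuclideanSpace.proj (𝕜 := ℝ) (Fin.last n)).hasFDerivAt

theorem contDiff_lastc {n : ℕ} {m : WithTop ℕ∞} : ContDiff ℝ m (lastc (n := n)) :=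
  (EuclideanSpace.proj (𝕜 := ℝ) (Fin.last n)).contDiff

theorem pd_lastc {n : ℕ} (i : Fin (n + 1)) (x : UE n) :
    pd i lastc x = if i = Fin.last n then 1 else 0 := by
  simp [pd, (hasFDerivAt_lastc x).fderiv, eq_comm]

section

variable {n : ℕ} {f g w : UE n → ℝ}

theorem differentiableAt_of_contDiffOn_halfSpace {m : WithTop ℕ∞}
    (hf : ContDiffOn ℝ m f (HalfSpace n)) (hm : m ≠ 0) {x : UE n} (hx : x ∈ HalfSpace n) :
    DifferentiableAt ℝ f x :=
  (hf.contDiffAt ((isOpen_halfSpace n).mem_nhds hx)).differentiableAt hm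

theorem eqOn_pd (h : EqOn f g (HalfSpace n)) (i : Fin (n + 1)) :
    EqOn (pd i f) (pd i g) (HalfSpace n) := fun x hx => by
  have hfg : f =ᶠ[𝓝 x] g := h.eventuallyEq_of_mem ((isOpen_halfSpace n).mem_nhds hx)
  simp only [pd, hfg.fderiv_eq]

theorem eqOn_lap (h : EqOn f g (HalfSpace n)) : EqOn (lap f) (lap g) (HalfSpace n) :=
  fun _ hx => Finset.sum_congr rfl fun i _ => eqOn_pd (eqOn_pd h i) i hx

theorem contDiffOn_pd {m k : WithTop ℕ∞} (hf : ContDiffOn ℝ k f (HalfSpace n)) (hmk : m + 1 ≤ k)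
    (i : Fin (n + 1)) : ContDiffOn ℝ m (pd i f) (HalfSpace n) :=
  (hf.fderiv_of_isOpen (isOpen_halfSpace n) hmk).clm_apply contDiffOn_const

theorem pd_add (i : Fin (n + 1)) {x : UE n} (hf : DifferentiableAt ℝ f x)
    (hg : DifferentiableAt ℝ g x) : pd i (fun y => f y + g y) x = pd i f x + pd i g x := by
  simp [pd, fderiv_fun_add hf hg]

theorem pd_const_mul (i : Fin (n + 1)) {x : UE n} (c : ℝ) (hf : DifferentiableAt ℝ f x) :
    pd i (fun y => c * f y) x = c * pd i f x := by
  simp [pd, fderiv_const_mul hf c]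

theorem pd_lastc_mul (i : Fin (n + 1)) {x : UE n} (hg : DifferentiableAt ℝ g x) :
    pd i (fun y => lastc y * g y) x =
      lastc x * pd i g x + (if i = Fin.last n then 1 else 0) * g x := by
  rw [← pd_lastc i x]
  simp only [pd, fderiv_fun_mul (hasFDerivAt_lastc x).differentiableAt hg, add_apply, smul_apply,
    smul_eq_mul]
  ring

theorem pd_comm (hf : ContDiffOn ℝ 2 f (HalfSpace n)) (i j : Fin (n + 1)) {x : UE n}
    (hx : x ∈ HalfSpace n) : pd i (pd j f) x = pd j (pd i f) x := by
  have hd : DifferentiableAt ℝ (fderiv ℝ f) x :=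
    ((hf.fderiv_of_isOpen (m := 1) (isOpen_halfSpace n) (by norm_num)).contDiffAt
      ((isOpen_halfSpace n).mem_nhds hx)).differentiableAt one_ne_zero
  have key : ∀ i j, pd i (pd j f) x =
      fderiv ℝ (fderiv ℝ f) x (EuclideanSpace.single i 1) (EuclideanSpace.single j 1) := by
    intro i j
    unfold pd
    simp [fderiv_clm_apply hd (differentiableAt_const _)]
  rw [key, key]
  exact (hf.contDiffAt ((isOpen_halfSpace n).mem_nhds hx)).isSymmSndFDerivAt (by simp) _ _

theorem pd_lap (hf : ContDiffOn ℝ 3 f (HalfSpace n)) (j : Fin (n + 1)) {x : UE n}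
    (hx : x ∈ HalfSpace n) : pd j (lap f) x = lap (pd j f) x := by
  have h2 : ∀ i, ContDiffOn ℝ 2 (pd i f) (HalfSpace n) :=
    contDiffOn_pd hf (by norm_num)
  have h1 : ∀ i, DifferentiableAt ℝ (pd i (pd i f)) x := fun i =>
    differentiableAt_of_contDiffOn_halfSpace
      (contDiffOn_pd (m := 1) (h2 i) (by norm_num) i) one_ne_zero hx
  have hsum : pd j (lap f) x = ∑ i, pd j (pd i (pd i f)) x := by
    change fderiv ℝ (fun y => ∑ i, pd i (pd i f) y) x _ = _
    rw [fderiv_fun_sum fun i _ => h1 i]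
    simp [pd]
  rw [hsum]
  refine Finset.sum_congr rfl fun i _ => ?_
  rw [pd_comm (h2 i) j i hx]
  exact eqOn_pd (fun y hy => pd_comm (hf.of_le (by norm_num)) j i hy) i hx

theorem lap_const_mul (c : ℝ) (hf : ContDiffOn ℝ 2 f (HalfSpace n)) {x : UE n}
    (hx : x ∈ HalfSpace n) : lap (fun y => c * f y) x = c * lap f x := by
  unfold lap
  rw [Finset.mul_sum]
  refine Finset.sum_congr rfl fun i _ => ?_
  have h1 : EqOn (pd i fun y => c * f y) (fun y => c * pd i f y) (HalfSpace n) := fun y hy =>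
    pd_const_mul i c (differentiableAt_of_contDiffOn_halfSpace hf two_ne_zero hy)
  rw [eqOn_pd h1 i hx]
  exact pd_const_mul i c (differentiableAt_of_contDiffOn_halfSpace
    (contDiffOn_pd (m := 1) hf (by norm_num) i) one_ne_zero hx)

theorem lap_lastc_mul (hg : ContDiffOn ℝ 2 g (HalfSpace n)) {x : UE n} (hx : x ∈ HalfSpace n) :
    lap (fun y => lastc y * g y) x = lastc x * lap g x + 2 * pd (Fin.last n) g x := by
  have hterm : ∀ i, pd i (pd i fun y => lastc y * g y) x =
      lastc x * pd i (pd i g) x + if i = Fin.last n then 2 * pd i g x else 0 := by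
    intro i
    have hgd := differentiableAt_of_contDiffOn_halfSpace hg two_ne_zero hx
    have hpd : DifferentiableAt ℝ (pd i g) x := differentiableAt_of_contDiffOn_halfSpace
      (contDiffOn_pd (m := 1) hg (by norm_num) i) one_ne_zero hx
    have h1 : EqOn (pd i fun y => lastc y * g y)
        (fun y => lastc y * pd i g y + (if i = Fin.last n then 1 else 0) * g y) (HalfSpace n) :=
      fun y hy => pd_lastc_mul i (differentiableAt_of_contDiffOn_halfSpace hg two_ne_zero hy)
    rw [eqOn_pd h1 i hx, pd_add i ((hasFDerivAt_lastc x).differentiableAt.fun_mul hpd)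
      (hgd.const_mul _), pd_lastc_mul i hpd, pd_const_mul i _ hgd]
    split_ifs <;> ring
  unfold lap
  simp [hterm, Finset.sum_add_distrib, Finset.mul_sum]

theorem contDiffOn_deltaB (b : ℝ) (hf : ContDiffOn ℝ (⊤ : ℕ∞) f (HalfSpace n)) :
    ContDiffOn ℝ (⊤ : ℕ∞) (DeltaB b f) (HalfSpace n) := by
  have hpd : ∀ {g : UE n → ℝ}, ContDiffOn ℝ (⊤ : ℕ∞) g (HalfSpace n) → ∀ i,
      ContDiffOn ℝ (⊤ : ℕ∞) (pd i g) (HalfSpace n) := fun hg => contDiffOn_pd hg (by simp)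
  exact (ContDiffOn.sum fun i _ => hpd (hpd hf i) i).add
    ((contDiffOn_const.div contDiff_lastc.contDiffOn fun x hx => ne_of_gt hx).mul (hpd hf _))

theorem degEq_pd_last_div_lastc {a : ℝ} (hw : ContDiffOn ℝ 3 w (HalfSpace n))
    (h : ∀ x ∈ HalfSpace n, DegEq a w x) {x : UE n} (hx : x ∈ HalfSpace n) :
    DegEq (a + 2) (fun y => pd (Fin.last n) w y / lastc y) x := by
  set g : UE n → ℝ := fun y => pd (Fin.last n) w y / lastc y with hgdef
  have hg : ContDiffOn ℝ 2 g (HalfSpace n) :=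
    (contDiffOn_pd hw (by norm_num) _).div contDiff_lastc.contDiffOn fun x hx => ne_of_gt hx
  have hmul : EqOn (pd (Fin.last n) w) (fun y => lastc y * g y) (HalfSpace n) := fun y hy =>
    (mul_div_cancel₀ _ (ne_of_gt hy)).symm
  have hlap : EqOn (lap w) (fun y => -a * g y) (HalfSpace n) := fun y hy => by
    have := h y hy
    simp only [DegEq] at this
    simp only [hgdef]
    linear_combination this
  have h1 := pd_lap hw (Fin.last n) hx
  rw [eqOn_pd hlap _ hx, eqOn_lap hmul hx, lap_lastc_mul hg hx, pd_const_mul _ _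
    (differentiableAt_of_contDiffOn_halfSpace hg two_ne_zero hx)] at h1
  have hx0 : lastc x ≠ 0 := ne_of_gt hx
  unfold DegEq
  field_simp
  linear_combination -h1

theorem degEq_deltaB {a : ℝ} (b : ℝ) (hw : ContDiffOn ℝ 3 w (HalfSpace n))
    (h : ∀ x ∈ HalfSpace n, DegEq a w x) {x : UE n} (hx : x ∈ HalfSpace n) :
    DegEq (a + 2) (DeltaB b w) x := by
  have hg : ContDiffOn ℝ 2 (fun y => pd (Fin.last n) w y / lastc y) (HalfSpace n) :=
    (contDiffOn_pd hw (by norm_num) _).div contDiff_lastc.contDiffOn fun x hx => ne_of_gt hx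
  have heq : EqOn (DeltaB b w) (fun y => (b - a) * (pd (Fin.last n) w y / lastc y))
      (HalfSpace n) := fun y hy => by
    have := h y hy
    simp only [DegEq] at this
    simp only [DeltaB]
    linear_combination this
  have h1 := degEq_pd_last_div_lastc hw h hx
  unfold DegEq at h1 ⊢
  rw [eqOn_lap heq hx, eqOn_pd heq _ hx, lap_const_mul _ hg hx, pd_const_mul _ _
    (differentiableAt_of_contDiffOn_halfSpace hg two_ne_zero hx)]
  linear_combination (b - a) * h1

theorem contDiffOn_and_degEq_iterate_deltaB {a : ℝ} (b : ℝ)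
    (hw : ContDiffOn ℝ (⊤ : ℕ∞) w (HalfSpace n)) (h : ∀ x ∈ HalfSpace n, DegEq a w x) (k : ℕ) :
    ContDiffOn ℝ (⊤ : ℕ∞) ((DeltaB b)^[k] w) (HalfSpace n) ∧
      ∀ x ∈ HalfSpace n, DegEq (a + 2 * k) ((DeltaB b)^[k] w) x := by
  induction k with
  | zero => simpa using ⟨hw, h⟩
  | succ k ih =>
    rw [Function.iterate_succ_apply']
    refine ⟨contDiffOn_deltaB b ih.1, fun x hx => ?_⟩
    have hle : (3 : WithTop ℕ∞) ≤ ((⊤ : ℕ∞) : WithTop ℕ∞) := by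
      have : (((3 : ℕ) : ℕ∞) : WithTop ℕ∞) ≤ ((⊤ : ℕ∞) : WithTop ℕ∞) :=
        WithTop.coe_le_coe.2 le_top
      simpa using this
    have := degEq_deltaB b (ih.1.of_le hle) ih.2 hx
    convert this using 1
    push_cast
    ring

end

/-- **Recursion identity for the degenerate Laplacian** (Lemma A.2). -/
theorem degenerate_laplacian_recursion (n : ℕ) (hn : 1 ≤ n) :
    (∀ (a b : ℝ) (w : UE n → ℝ),
      ContDiffOn ℝ 4 w (HalfSpace n) →
      (∀ x ∈ HalfSpace n, DegEq a w x) →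
      ∀ x ∈ HalfSpace n, DegEq (a + 2) (DeltaB b w) x) ∧
    (∀ (γ : ℝ), 0 < γ → ∀ u : UE n → ℝ,
      ContDiffOn ℝ (⊤ : ℕ∞) u (HalfSpace n) →
      (∀ x ∈ HalfSpace n, DegEq (1 - 2 * γ) u x) →
      (∀ k : ℕ, k ≤ ⌊γ⌋₊ →
        ∀ x ∈ HalfSpace n,
          DegEq (1 - 2 * γ + 2 * k) ((DeltaB (1 - 2 * γ + 2 * ⌊γ⌋₊))^[k] u) x) ∧
      (∀ x ∈ HalfSpace n, (DeltaB (1 - 2 * γ + 2 * ⌊γ⌋₊))^[⌊γ⌋₊ + 1] u x = 0)) := by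
  refine ⟨fun a b w hw h x hx => degEq_deltaB b (hw.of_le (by norm_num)) h hx,
    fun γ _ u hu h => ⟨fun k _ => (contDiffOn_and_degEq_iterate_deltaB _ hu h k).2,
      fun x hx => ?_⟩⟩
  rw [Function.iterate_succ_apply']
  exact (contDiffOn_and_degEq_iterate_deltaB _ hu h ⌊γ⌋₊).2 x hx
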